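/- arXiv:2403.04033 — 3 statements merged into one kernel-verified Lean document; each statement's English description precedes it below -/
import Mathlib

section
/- Let F_0 be a class of functions from A × X to [−1,1], let (a_1,x_1),…,(a_T,x_T) ∈ A × X, let ẑ_1,…,ẑ_T ∈ ℝ, let R ≥ 1, and for each t ∈ [T] let F_t := {f ∈ F_0 : Σ_{s=1}^{t−1} (f(a_s,x_s) − ẑ_s)² ≤ R} be the version space at time t. Then for every α > 0, the cumulative width of the version spaces along the played sequence satisfies Σ_{t=1}^T Δ_{F_t}(a_t,x_t) ≤ α T + (20 R / α) · E(F_0, α). -/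
/-- Width of a class of real-valued functions at a point:
`Δ_G(s) = sup_{g,g' ∈ G} (g(s) - g'(s))`. -/
noncomputable def fnWidth {S : Type*} (G : Set (S → ℝ)) (s : S) : ℝ :=
  sSup {y : ℝ | ∃ g ∈ G, ∃ g' ∈ G, y = g s - g' s}

/-- `q` is ε-dependent, w.r.t. the class `F`, on the subsequence of `p` indexed by the
finite index set `I`. -/
def epsDep {S : Type*} (F : Set (S → ℝ)) (ε : ℝ) (p : ℕ → S) (I : Finset ℕ) (q : S) : Prop :=
  ∀ f ∈ F, ∀ f' ∈ F,
    Real.sqrt (∑ i ∈ I, (f (p i) - f' (p i)) ^ 2) ≤ ε → f q - f' q ≤ ε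

/-- There is a sequence of length `n` such that, for some `ε' > ε`, every element is
`ε'`-independent of its predecessors w.r.t. `F` (the defining property of the
eluder dimension at scale `ε`). -/
def eluderSeq {S : Type*} (F : Set (S → ℝ)) (ε : ℝ) (n : ℕ) : Prop :=
  ∃ ε' > ε, ∃ p : ℕ → S, ∀ i < n, ¬ epsDep F ε' p (Finset.range i) (p i)

/-- A finite set of indices, each independent of the smaller ones in the set, can be enumerated
as a sequence each of whose elements is independent of its predecessors. -/
lemma exists_seq_of_indep {S : Type*} (F : Set (S → ℝ)) (ε : ℝ) (p : ℕ → S) (B : Finset ℕ)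
    (hB : ∀ t ∈ B, ¬ epsDep F ε p (B.filter (· < t)) (p t)) :
    ∃ q : ℕ → S,
      (∀ g : S → ℝ, ∑ i ∈ Finset.range B.card, g (q i) = ∑ t ∈ B, g (p t)) ∧
      ∀ i < B.card, ¬ epsDep F ε q (Finset.range i) (q i) := by
  induction B using Finset.induction_on_max with
  | empty => exact ⟨p, by simp, by simp⟩
  | insert a s has ih =>
    have ha : a ∉ s := fun h => lt_irrefl _ (has a h)
    obtain ⟨q, hq, hind⟩ := ih (fun t ht => by
      have h := hB t (Finset.mem_insert_of_mem ht)
      rwa [Finset.filter_insert, if_neg (has t ht).le.not_gt] at h)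
    have hcongr : ∀ n ≤ s.card, ∀ g : S → ℝ,
        ∑ i ∈ Finset.range n, g (Function.update q s.card (p a) i)
          = ∑ i ∈ Finset.range n, g (q i) := by
      intro n hn g
      refine Finset.sum_congr rfl fun i hi => ?_
      rw [Function.update_of_ne]
      have := Finset.mem_range.1 hi
      omega
    refine ⟨Function.update q s.card (p a), ?_, ?_⟩
    · intro g
      rw [Finset.card_insert_of_notMem ha, Finset.sum_range_succ, hcongr _ le_rfl, hq,
        Finset.sum_insert ha, Function.update_self, add_comm]
    · intro i hi hdep
      rw [Finset.card_insert_of_notMem ha] at hi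
      rcases Nat.lt_succ_iff_lt_or_eq.1 hi with h | rfl
      · refine hind i h fun f hf f' hf' hle => ?_
        have := hdep f hf f' hf'
        rw [hcongr i h.le (fun x => (f x - f' x) ^ 2), Function.update_of_ne h.ne] at this
        exact this hle
      · refine hB a (Finset.mem_insert_self _ _) fun f hf f' hf' hle => ?_
        have := hdep f hf f' hf'
        rw [hcongr _ le_rfl (fun x => (f x - f' x) ^ 2), hq (fun x => (f x - f' x) ^ 2),
          Function.update_self] at this
        rw [Finset.filter_insert, if_neg (lt_irrefl _), Finset.filter_true_of_mem has] at hle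
        exact this hle

/-- If no element indexed by `W` is dependent on `K` disjoint sets of earlier elements, then `W`
can be coloured with `K` colours so that each element is independent of the earlier ones of its
own colour. -/
lemma exists_coloring {S : Type*} (F : Set (S → ℝ)) (ε : ℝ) (p : ℕ → S) (W : Finset ℕ) (K : ℕ)
    (hW : ∀ t ∈ W, ∀ c : ℕ → ℕ,
      ∃ k < K, ¬ epsDep F ε p (W.filter (fun s => s < t ∧ c s = k)) (p t)) (n : ℕ) :
    ∃ c : ℕ → ℕ, ∀ t ∈ W, t < n →
      c t < K ∧ ¬ epsDep F ε p (W.filter (fun s => s < t ∧ c s = c t)) (p t) := by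
  induction n with
  | zero => exact ⟨id, by simp⟩
  | succ n ih =>
    obtain ⟨c, hc⟩ := ih
    by_cases hn : n ∈ W
    · obtain ⟨k, hk, hdep⟩ := hW n hn c
      have hfilter : ∀ t ≤ n, ∀ j,
          W.filter (fun s => s < t ∧ Function.update c n k s = j)
            = W.filter (fun s => s < t ∧ c s = j) := by
        intro t ht j
        refine Finset.filter_congr fun s _ => and_congr_right fun hs => ?_
        rw [Function.update_of_ne (by omega)]
      refine ⟨Function.update c n k, fun t ht htn => ?_⟩
      rw [hfilter t (by omega)]
      rcases Nat.lt_succ_iff_lt_or_eq.1 htn with h | rfl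
      · rw [Function.update_of_ne h.ne]
        exact hc t ht h
      · rw [Function.update_self]
        exact ⟨hk, hdep⟩
    · refine ⟨c, fun t ht htn => hc t ht ?_⟩
      rcases Nat.lt_succ_iff_lt_or_eq.1 htn with h | rfl
      · exact h
      · exact absurd ht hn

/-- If no element indexed by `W` is dependent on `K` disjoint sets of earlier elements, then `W`
has at most `K * d` elements, where `d` bounds the lengths of eluder sequences. -/
lemma card_le_mul_of_indep {S : Type*} (F : Set (S → ℝ)) {α ε : ℝ} (hε : α < ε) (p : ℕ → S)
    (W : Finset ℕ) (K d : ℕ) (hd : ∀ n, eluderSeq F α n → n ≤ d)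
    (hW : ∀ t ∈ W, ∀ c : ℕ → ℕ,
      ∃ k < K, ¬ epsDep F ε p (W.filter (fun s => s < t ∧ c s = k)) (p t)) :
    W.card ≤ K * d := by
  obtain ⟨c, hc⟩ := exists_coloring F ε p W K hW (W.sup id + 1)
  replace hc : ∀ t ∈ W,
      c t < K ∧ ¬ epsDep F ε p (W.filter (fun s => s < t ∧ c s = c t)) (p t) :=
    fun t ht => hc t ht (Nat.lt_succ_of_le (Finset.le_sup (f := id) ht))
  have hbin : ∀ k ∈ Finset.range K, (W.filter (fun t => c t = k)).card ≤ d := by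
    intro k _
    obtain ⟨q, -, hq⟩ := exists_seq_of_indep F ε p (W.filter (fun t => c t = k)) (by
      intro t ht
      obtain ⟨htW, rfl⟩ := Finset.mem_filter.1 ht
      have h := (hc t htW).2
      rw [Finset.filter_filter]
      simpa only [and_comm] using h)
    exact hd _ ⟨ε, hε, q, hq⟩
  have := Finset.card_le_mul_card_image_of_maps_to
    (f := c) (s := W) (t := Finset.range K) (fun t ht => Finset.mem_range.2 (hc t ht).1) d hbin
  rwa [Finset.card_range, mul_comm] at this

lemma sum_sq_sub_le {ι : Type*} (I : Finset ι) (u v z : ι → ℝ) {R : ℝ}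
    (hu : ∑ i ∈ I, (u i - z i) ^ 2 ≤ R) (hv : ∑ i ∈ I, (v i - z i) ^ 2 ≤ R) :
    ∑ i ∈ I, (u i - v i) ^ 2 ≤ 4 * R := by
  have h : ∑ i ∈ I, (u i - v i) ^ 2
      ≤ ∑ i ∈ I, (2 * (u i - z i) ^ 2 + 2 * (v i - z i) ^ 2) :=
    Finset.sum_le_sum fun i _ => by nlinarith [sq_nonneg ((u i - z i) + (v i - z i))]
  rw [Finset.sum_add_distrib, ← Finset.mul_sum, ← Finset.mul_sum] at h
  linarith

lemma exists_lt_sub_of_lt_fnWidth {S : Type*} {G : Set (S → ℝ)} {s : S} {ε : ℝ} (hε : 0 ≤ ε)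
    (h : ε < fnWidth G s) : ∃ g ∈ G, ∃ g' ∈ G, ε < g s - g' s := by
  by_contra! hcon
  refine h.not_ge (Real.sSup_le ?_ hε)
  rintro y ⟨g, hg, g', hg', rfl⟩
  exact hcon g hg g' hg'

/-- An element at which two functions of total squared distance at most `M` differ by more than
`ε` is independent of one of any `K` disjoint sets of earlier elements, as soon as
`M ≤ K * ε ^ 2`. -/
lemma exists_not_epsDep {S : Type*} (F : Set (S → ℝ)) {ε M : ℝ} (hε : 0 < ε) (p : ℕ → S)
    (W : Finset ℕ) {K t : ℕ} (hK : 0 < K) (hM : M ≤ K * ε ^ 2) {f f' : S → ℝ} (hf : f ∈ F)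
    (hf' : f' ∈ F) (hlt : ε < f (p t) - f' (p t))
    (hsum : ∑ s ∈ Finset.range t, (f (p s) - f' (p s)) ^ 2 ≤ M) (c : ℕ → ℕ) :
    ∃ k < K, ¬ epsDep F ε p (W.filter (fun s => s < t ∧ c s = k)) (p t) := by
  by_contra! hdep
  have hbig : ∀ k ∈ Finset.range K,
      ε ^ 2 < ∑ s ∈ W.filter (fun s => s < t ∧ c s = k), (f (p s) - f' (p s)) ^ 2 := by
    intro k hk
    by_contra! hle
    refine hlt.not_ge (hdep k (Finset.mem_range.1 hk) f hf f' hf' ?_)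
    exact (Real.sqrt_le_left hε.le).2 hle
  have hlow := Finset.sum_lt_sum_of_nonempty (Finset.nonempty_range_iff.2 hK.ne') hbig
  have hdisj : Set.PairwiseDisjoint (Finset.range K : Set ℕ)
      (fun k => W.filter (fun s => s < t ∧ c s = k)) := by
    intro i _ j _ hij
    refine Finset.disjoint_left.2 fun s hs hs' => hij ?_
    rw [← (Finset.mem_filter.1 hs).2.2, ← (Finset.mem_filter.1 hs').2.2]
  rw [← Finset.sum_biUnion hdisj, Finset.sum_const, Finset.card_range, nsmul_eq_mul] at hlow
  have hsub : (Finset.range K).biUnion (fun k => W.filter (fun s => s < t ∧ c s = k))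
      ⊆ Finset.range t := by
    intro s hs
    obtain ⟨k, -, hk⟩ := Finset.mem_biUnion.1 hs
    exact Finset.mem_range.2 (Finset.mem_filter.1 hk).2.1
  have := Finset.sum_le_sum_of_subset_of_nonneg hsub
    (f := fun s => (f (p s) - f' (p s)) ^ 2) (fun _ _ _ => sq_nonneg _)
  linarith

/-- The number of times the width of the version space exceeds a level `ε > α`. -/
lemma card_width_gt_le {S : Type*} (F : Set (S → ℝ))
    (hbdd : ∀ f ∈ F, ∀ s, f s ∈ Set.Icc (-1 : ℝ) 1) (T : ℕ) (p : ℕ → S) (z : ℕ → ℝ) {R : ℝ}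
    (hR : 1 ≤ R) (Fc : ℕ → Set (S → ℝ))
    (hFc : ∀ t, Fc t = {f ∈ F | ∑ s ∈ Finset.range t, (f (p s) - z s) ^ 2 ≤ R})
    {α ε : ℝ} (hα : 0 < α) (hε : α < ε) (d : ℕ) (hd : ∀ n, eluderSeq F α n → n ≤ d) :
    (((Finset.range T).filter (fun t => ε < fnWidth (Fc t) (p t))).card : ℝ)
      ≤ 8 * R * d / ε ^ 2 := by
  have hε0 : 0 < ε := hα.trans hε
  set W := (Finset.range T).filter (fun t => ε < fnWidth (Fc t) (p t))
  have hwit : ∀ t ∈ W, ∃ f ∈ F, ∃ f' ∈ F, ε < f (p t) - f' (p t) ∧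
      ∑ s ∈ Finset.range t, (f (p s) - f' (p s)) ^ 2 ≤ 4 * R := by
    intro t ht
    obtain ⟨f, hf, f', hf', hlt⟩ :=
      exists_lt_sub_of_lt_fnWidth hε0.le (Finset.mem_filter.1 ht).2
    rw [hFc] at hf hf'
    exact ⟨f, hf.1, f', hf'.1, hlt, sum_sq_sub_le _ _ _ _ hf.2 hf'.2⟩
  rcases W.eq_empty_or_nonempty with hW | ⟨t₀, ht₀⟩
  · rw [hW, Finset.card_empty, Nat.cast_zero]
    positivity
  have hε2 : ε < 2 := by
    obtain ⟨f, hf, f', hf', hlt, -⟩ := hwit t₀ ht₀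
    linarith [(hbdd f hf (p t₀)).2, (hbdd f' hf' (p t₀)).1]
  have hsq : 0 < ε ^ 2 := by positivity
  have hM : 4 * R ≤ (⌈4 * R / ε ^ 2⌉₊ : ℝ) * ε ^ 2 := (div_le_iff₀ hsq).1 (Nat.le_ceil _)
  have hcard : W.card ≤ ⌈4 * R / ε ^ 2⌉₊ * d := by
    refine card_le_mul_of_indep F hε p W _ d hd fun t ht c => ?_
    obtain ⟨f, hf, f', hf', hlt, hsum⟩ := hwit t ht
    exact exists_not_epsDep F hε0 p W (Nat.ceil_pos.2 (by positivity)) hM hf hf' hlt hsum c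
  have hceil : (⌈4 * R / ε ^ 2⌉₊ : ℝ) ≤ 8 * R / ε ^ 2 := by
    have h1 : (⌈4 * R / ε ^ 2⌉₊ : ℝ) < 4 * R / ε ^ 2 + 1 := Nat.ceil_lt_add_one (by positivity)
    have h2 : 1 ≤ 4 * R / ε ^ 2 := by
      rw [le_div_iff₀ hsq]
      nlinarith
    have h3 : 8 * R / ε ^ 2 = 4 * R / ε ^ 2 + 4 * R / ε ^ 2 := by ring
    linarith
  calc (W.card : ℝ) ≤ (⌈4 * R / ε ^ 2⌉₊ : ℝ) * d := by exact_mod_cast hcard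
    _ ≤ 8 * R / ε ^ 2 * d := by gcongr
    _ = 8 * R * d / ε ^ 2 := by ring

lemma min_le_add_sum_dyadic (w β : ℝ) (m : ℕ) :
    min w (β * 2 ^ m)
      ≤ β + ∑ k ∈ Finset.range m, if β * 2 ^ k < w then β * 2 ^ k else 0 := by
  induction m with
  | zero => simp
  | succ m ih =>
    rw [Finset.sum_range_succ]
    split_ifs with h
    · rw [min_eq_right h.le] at ih
      have : min w (β * 2 ^ (m + 1)) ≤ β * 2 ^ m + β * 2 ^ m :=
        (min_le_right _ _).trans (by rw [pow_succ]; linarith)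
      linarith
    · rw [min_eq_left (not_lt.1 h)] at ih
      exact (min_le_left _ _).trans (by linarith)

/-- A dyadic layer-cake bound: if the number of indices at which `w` exceeds a level `ε ≥ β` is at
most `C / ε ^ 2`, then the sum of `w` is at most `β * T + 2 * C / β`. -/
lemma sum_le_of_card_gt_le (w : ℕ → ℝ) {M : ℝ} (hw : ∀ t, w t ≤ M) (T : ℕ) {β C : ℝ}
    (hβ : 0 < β) (hC : 0 ≤ C)
    (h : ∀ ε, β ≤ ε → (((Finset.range T).filter (fun t => ε < w t)).card : ℝ) ≤ C / ε ^ 2) :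
    ∑ t ∈ Finset.range T, w t ≤ β * T + 2 * C / β := by
  obtain ⟨m, hm⟩ := pow_unbounded_of_one_lt (M / β) (one_lt_two : (1 : ℝ) < 2)
  rw [div_lt_iff₀ hβ, mul_comm] at hm
  calc ∑ t ∈ Finset.range T, w t
      ≤ ∑ t ∈ Finset.range T,
          (β + ∑ k ∈ Finset.range m, if β * 2 ^ k < w t then β * 2 ^ k else 0) := by
        refine Finset.sum_le_sum fun t _ => ?_
        have := min_le_add_sum_dyadic (w t) β m
        rwa [min_eq_left ((hw t).trans hm.le)] at this
    _ = β * T + ∑ k ∈ Finset.range m,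
          (((Finset.range T).filter (fun t => β * 2 ^ k < w t)).card : ℝ) * (β * 2 ^ k) := by
        rw [Finset.sum_add_distrib, Finset.sum_comm, Finset.sum_const, Finset.card_range,
          nsmul_eq_mul, mul_comm (T : ℝ)]
        congr 1
        refine Finset.sum_congr rfl fun k _ => ?_
        rw [← Finset.sum_filter, Finset.sum_const, nsmul_eq_mul]
    _ ≤ β * T + ∑ k ∈ Finset.range m, C / β * (1 / 2 : ℝ) ^ k := by
        refine add_le_add_right (Finset.sum_le_sum fun k _ => ?_) _
        have hk : β ≤ β * 2 ^ k := le_mul_of_one_le_right hβ.le (one_le_pow₀ one_le_two)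
        calc _ ≤ C / (β * 2 ^ k) ^ 2 * (β * 2 ^ k) := by gcongr; exact h _ hk
          _ = C / β * (1 / 2 : ℝ) ^ k := by
            rw [one_div, inv_pow]
            field_simp
    _ ≤ β * T + C / β * 2 := by
        rw [← Finset.mul_sum]
        gcongr
        exact sum_geometric_two_le m
    _ = β * T + 2 * C / β := by ring

/-- with version spaces
`F_t = {f ∈ F_0 : ∑_{s<t} (f(a_s,x_s) - ẑ_s)² ≤ R}` and `R ≥ 1`, the cumulative width of
the version spaces along the played sequence satisfies, for every `α > 0`,
`∑_{t<T} Δ_{F_t}(a_t,x_t) ≤ α T + (20 R / α) · E(F_0, α)`, where `d = E(F_0, α)` is the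
eluder dimension (the greatest length of an eluder sequence at scale `α`). -/
theorem sum_of_widths_bound
    {A X : Type*} (F0 : Set (A × X → ℝ))
    (hbdd : ∀ f ∈ F0, ∀ p : A × X, f p ∈ Set.Icc (-1 : ℝ) 1)
    (T : ℕ) (p : ℕ → A × X) (zhat : ℕ → ℝ) (R : ℝ) (hR : 1 ≤ R)
    (Fc : ℕ → Set (A × X → ℝ))
    (hFc : ∀ t, Fc t = {f ∈ F0 | ∑ s ∈ Finset.range t, (f (p s) - zhat s) ^ 2 ≤ R})
    (α : ℝ) (hα : 0 < α) (d : ℕ)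
    (hd : IsGreatest {n : ℕ | eluderSeq F0 α n} d) :
    ∑ t ∈ Finset.range T, fnWidth (Fc t) (p t) ≤ α * T + (20 * R / α) * d := by
  have hw : ∀ t, fnWidth (Fc t) (p t) ≤ 2 := by
    intro t
    refine Real.sSup_le ?_ zero_le_two
    rintro y ⟨g, hg, g', hg', rfl⟩
    rw [hFc] at hg hg'
    linarith [(hbdd g hg.1 (p t)).2, (hbdd g' hg'.1 (p t)).1]
  have hβ : ∀ β, α < β →
      ∑ t ∈ Finset.range T, fnWidth (Fc t) (p t) ≤ β * T + (20 * R / α) * d := by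
    intro β hαβ
    refine (sum_le_of_card_gt_le (C := 8 * R * d) _ hw T (hα.trans hαβ) (by positivity)
      fun ε hε => card_width_gt_le F0 hbdd T p zhat hR Fc hFc hα (hαβ.trans_le hε) d
        fun n hn => hd.2 hn).trans ?_
    gcongr
    calc 2 * (8 * R * d) / β ≤ 2 * (8 * R * d) / α := by gcongr
      _ = 16 * R / α * d := by ring
      _ ≤ 20 * R / α * d := by gcongr; norm_num
  have hcont : ContinuousWithinAt (fun β : ℝ => β * T + (20 * R / α) * d) (Set.Ioi α) α := by
    fun_prop
  exact ge_of_tendsto hcont (Filter.eventually_of_mem self_mem_nhdsWithin hβ)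
end

section
/- Let σ : ℝ → ℝ be differentiable and non-decreasing with σ(0) = 0 and c ≤ σ'(x) ≤ C for all x, where 0 < c ≤ C, and set r := C/c. Let W be a nonempty set of vectors in ℝ^d with ‖w‖ ≤ 1 for all w ∈ W, let b > 0, D_a > 0, D_ℓ ≥ 0, and let ã ∈ ℝ^d satisfy ‖ã‖ ≤ D_a and inf_{w ∈ W} σ(⟨w, ã⟩ − b) ≤ 0. Define Δ(a) := sup_{w,w' ∈ W} (σ(⟨w, a⟩ − b) − σ(⟨w', a⟩ − b)), let γ ∈ (0,1] satisfy γ ≥ b / (b + Δ(ã)/c), and let ℓ : ℝ^d → ℝ be D_ℓ-Lipschitz. Then ℓ(γ ã) − ℓ(ã) ≤ (r D_ℓ D_a / (b c)) · Δ(γ ã). -/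
open RealInnerProductSpace

/-- Width of the generalized-linear class `{a ↦ σ(⟨w, a⟩ − b) : w ∈ W}` at `a`:
`Δ(a) = sup_{w,w' ∈ W} (σ(⟨w, a⟩ − b) − σ(⟨w', a⟩ − b))`. -/
noncomputable def glWidth {d : ℕ} (σ : ℝ → ℝ) (b : ℝ) (W : Set (EuclideanSpace ℝ (Fin d)))
    (a : EuclideanSpace ℝ (Fin d)) : ℝ :=
  sSup {y : ℝ | ∃ w ∈ W, ∃ w' ∈ W, y = σ (⟪w, a⟫ - b) - σ (⟪w', a⟫ - b)}

lemma glWidth_bddAbove {d : ℕ} {σ : ℝ → ℝ} (hdiff : Differentiable ℝ σ) {C : ℝ} (hC : 0 ≤ C)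
    (hmono : Monotone σ) (hderiv : ∀ x, deriv σ x ≤ C) (b : ℝ)
    {W : Set (EuclideanSpace ℝ (Fin d))} (hW : ∀ w ∈ W, ‖w‖ ≤ 1)
    (a : EuclideanSpace ℝ (Fin d)) :
    BddAbove {y : ℝ | ∃ w ∈ W, ∃ w' ∈ W, y = σ (⟪w, a⟫ - b) - σ (⟪w', a⟫ - b)} := by
  refine ⟨C * (2 * ‖a‖), ?_⟩
  rintro _ ⟨w, hw, w', hw', rfl⟩
  have inner_bound : ∀ v ∈ W, |⟪v, a⟫| ≤ ‖a‖ := fun v hv =>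
    (abs_real_inner_le_norm v a).trans (mul_le_of_le_one_left (norm_nonneg a) (hW v hv))
  have h₁ := abs_le.mp (inner_bound w hw)
  have h₂ := abs_le.mp (inner_bound w' hw')
  rcases le_total ⟪w', a⟫ ⟪w, a⟫ with h | h
  · refine (image_sub_le_mul_sub_of_deriv_le hdiff hderiv (sub_le_sub_right h b)).trans ?_
    exact mul_le_mul_of_nonneg_left (by linarith) hC
  · have := hmono (sub_le_sub_right h b)
    have : 0 ≤ C * (2 * ‖a‖) := by positivity
    linarith

lemma glWidth_nonneg {d : ℕ} (σ : ℝ → ℝ) (b : ℝ) {W : Set (EuclideanSpace ℝ (Fin d))}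
    {a : EuclideanSpace ℝ (Fin d)} (hne : W.Nonempty)
    (hbdd : BddAbove {y : ℝ | ∃ w ∈ W, ∃ w' ∈ W, y = σ (⟪w, a⟫ - b) - σ (⟪w', a⟫ - b)}) :
    0 ≤ glWidth σ b W a := by
  obtain ⟨w, hw⟩ := hne
  exact le_csSup hbdd ⟨w, hw, w, hw, (sub_self _).symm⟩

lemma mul_glWidth_le_glWidth_smul {d : ℕ} {σ : ℝ → ℝ} (hdiff : Differentiable ℝ σ)
    (hmono : Monotone σ) {c C : ℝ} (hc : 0 < c) (hC : 0 ≤ C)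
    (hderiv : ∀ x, c ≤ deriv σ x ∧ deriv σ x ≤ C) (b : ℝ)
    {W : Set (EuclideanSpace ℝ (Fin d))} (hne : W.Nonempty) (hW : ∀ w ∈ W, ‖w‖ ≤ 1)
    (a : EuclideanSpace ℝ (Fin d)) {γ : ℝ} (hγ : 0 < γ) :
    γ * glWidth σ b W a ≤ C / c * glWidth σ b W (γ • a) := by
  have hbdd := glWidth_bddAbove hdiff hC hmono (fun x => (hderiv x).2) b hW (γ • a)
  rw [mul_comm, ← le_div_iff₀ hγ]
  obtain ⟨v, hv⟩ := hne
  refine csSup_le ⟨_, v, hv, v, hv, rfl⟩ ?_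
  rintro _ ⟨w, hw, w', hw', rfl⟩
  rw [le_div_iff₀ hγ]
  rcases le_total ⟪w', a⟫ ⟪w, a⟫ with h | h
  · have upper := image_sub_le_mul_sub_of_deriv_le hdiff (fun x => (hderiv x).2)
      (sub_le_sub_right h b)
    have lower := mul_sub_le_image_sub_of_le_deriv hdiff (fun x => (hderiv x).1)
      (sub_le_sub_right (mul_le_mul_of_nonneg_left h hγ.le) b)
    have width : σ (γ * ⟪w, a⟫ - b) - σ (γ * ⟪w', a⟫ - b) ≤ glWidth σ b W (γ • a) :=
      le_csSup hbdd ⟨w, hw, w', hw', by simp only [real_inner_smul_right]⟩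
    calc (σ (⟪w, a⟫ - b) - σ (⟪w', a⟫ - b)) * γ
        ≤ C * (⟪w, a⟫ - b - (⟪w', a⟫ - b)) * γ := mul_le_mul_of_nonneg_right upper hγ.le
      _ = C / c * (c * (γ * ⟪w, a⟫ - b - (γ * ⟪w', a⟫ - b))) := by field_simp; ring
      _ ≤ C / c * glWidth σ b W (γ • a) :=
        mul_le_mul_of_nonneg_left (lower.trans width) (by positivity)
  · have hσ := hmono (sub_le_sub_right h b)
    have hwidth := glWidth_nonneg σ b ⟨v, hv⟩ hbdd
    exact (mul_nonpos_of_nonpos_of_nonneg (sub_nonpos.mpr hσ) hγ.le).trans (by positivity)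

/-- generalized linear case. With `σ` differentiable, non-decreasing,
`σ(0) = 0`, `c ≤ σ' ≤ C` (`0 < c ≤ C`), `r = C/c`, `ã` optimistically feasible with
`‖ã‖ ≤ D_a`, `γ ∈ (0,1]` with `γ ≥ b/(b + Δ(ã)/c)`, and `ℓ` `D_ℓ`-Lipschitz, we get
`ℓ(γ ã) − ℓ(ã) ≤ (r D_ℓ D_a / (b c)) · Δ(γ ã)`. -/
theorem glm_scaling_loss_increase_bound
    {d : ℕ} (σ : ℝ → ℝ) (hdiff : Differentiable ℝ σ) (hmono : Monotone σ)
    (hσ0 : σ 0 = 0) (c C : ℝ) (hc : 0 < c) (hcC : c ≤ C)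
    (hderiv : ∀ x : ℝ, c ≤ deriv σ x ∧ deriv σ x ≤ C)
    (W : Set (EuclideanSpace ℝ (Fin d))) (hne : W.Nonempty)
    (hW : ∀ w ∈ W, ‖w‖ ≤ 1) (b Da Dl : ℝ) (hb : 0 < b) (hDa : 0 < Da) (hDl : 0 ≤ Dl)
    (atil : EuclideanSpace ℝ (Fin d)) (hnorm : ‖atil‖ ≤ Da)
    (hopt : sInf {y : ℝ | ∃ w ∈ W, y = σ (⟪w, atil⟫ - b)} ≤ 0)
    (γ : ℝ) (hγ : γ ∈ Set.Ioc (0 : ℝ) 1)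
    (hγlb : b / (b + glWidth σ b W atil / c) ≤ γ)
    (ℓ : EuclideanSpace ℝ (Fin d) → ℝ)
    (hLip : ∀ x y, dist (ℓ x) (ℓ y) ≤ Dl * dist x y) :
    ℓ (γ • atil) - ℓ atil ≤ ((C / c) * Dl * Da / (b * c)) * glWidth σ b W (γ • atil) := by
  have hC : 0 ≤ C := hc.le.trans hcC
  have width_nonneg := glWidth_nonneg σ b hne
    (glWidth_bddAbove hdiff hC hmono (fun x => (hderiv x).2) b hW atil)
  have hscale := mul_glWidth_le_glWidth_smul hdiff hmono hc hC hderiv b hne hW atil hγ.1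
  have hgap : 1 - γ ≤ C / c * glWidth σ b W (γ • atil) / (b * c) := by
    rw [div_le_iff₀ (by positivity)] at hγlb
    have hcancel : glWidth σ b W atil / c * c = glWidth σ b W atil := div_mul_cancel₀ _ hc.ne'
    rw [le_div_iff₀ (by positivity)]
    linear_combination hscale + c * hγlb + γ * hcancel
  have hdist : dist (γ • atil) atil ≤ (1 - γ) * Da := by
    have hsub : γ • atil - atil = (γ - 1) • atil := by rw [sub_smul, one_smul]
    rw [dist_eq_norm, hsub, norm_smul, Real.norm_eq_abs, abs_sub_comm,
      abs_of_nonneg (sub_nonneg.mpr hγ.2)]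
    exact mul_le_mul_of_nonneg_left hnorm (sub_nonneg.mpr hγ.2)
  calc ℓ (γ • atil) - ℓ atil ≤ dist (ℓ (γ • atil)) (ℓ atil) := le_abs_self _
    _ ≤ Dl * dist (γ • atil) atil := hLip _ _
    _ ≤ Dl * (C / c * glWidth σ b W (γ • atil) / (b * c) * Da) :=
      mul_le_mul_of_nonneg_left
        (hdist.trans (mul_le_mul_of_nonneg_right hgap hDa.le)) hDl
    _ = ((C / c) * Dl * Da / (b * c)) * glWidth σ b W (γ • atil) := by ring
end

section
/- Let W_1, …, W_m be nonempty sets of vectors in ℝ^d with ‖w‖ ≤ 1 for every w ∈ W_i and every i ∈ [m], let b > 0, D_a > 0, D_ℓ ≥ 0, and let ã ∈ ℝ^d satisfy ‖ã‖ ≤ D_a and inf_{w ∈ W_i} ⟨w, ã⟩ ≤ b for every i ∈ [m]. Define Δ(a) := max_{i ∈ [m]} sup_{w,w' ∈ W_i} ⟨w − w', a⟩, let γ ∈ [0,1] satisfy γ ≥ b / (b + Δ(ã)), and let ℓ : ℝ^d → ℝ be D_ℓ-Lipschitz. Then ℓ(γ ã) − ℓ(ã) ≤ (D_ℓ D_a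 / b) · Δ(γ ã). -/
open RealInnerProductSpace

/-- Width of a set of linear-constraint parameters at an action:
`Δ_W(a) = sup_{w,w' ∈ W} ⟨w - w', a⟩`. -/
noncomputable def linWidth {d : ℕ} (W : Set (EuclideanSpace ℝ (Fin d)))
    (a : EuclideanSpace ℝ (Fin d)) : ℝ :=
  sSup {y : ℝ | ∃ w ∈ W, ∃ w' ∈ W, y = ⟪w - w', a⟫}

/-- Combined width for `m` simultaneous linear constraints:
`Δ(a) = max_{i ∈ [m]} Δ_{W_i}(a)`. -/
noncomputable def multiWidth {d m : ℕ} (W : Fin m → Set (EuclideanSpace ℝ (Fin d)))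
    (a : EuclideanSpace ℝ (Fin d)) : ℝ :=
  ⨆ i : Fin m, linWidth (W i) a

/-- The width of a nonempty parameter set is nonnegative. -/
theorem linWidth_nonneg {d : ℕ} {W : Set (EuclideanSpace ℝ (Fin d))} (hW : W.Nonempty)
    (a : EuclideanSpace ℝ (Fin d)) : 0 ≤ linWidth W a := by
  obtain ⟨w, hw⟩ := hW
  exact Real.sSup_nonneg' ⟨0, ⟨w, hw, w, hw, by simp⟩, le_rfl⟩

/-- The width is positively homogeneous in the action. -/
theorem linWidth_smul {d : ℕ} (W : Set (EuclideanSpace ℝ (Fin d))) {c : ℝ} (hc : 0 ≤ c)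
    (a : EuclideanSpace ℝ (Fin d)) : linWidth W (c • a) = c * linWidth W a := by
  unfold linWidth
  rw [← smul_eq_mul, ← Real.sSup_smul_of_nonneg hc]
  congr 1
  ext y
  simp only [Set.mem_ofPred_eq, Set.mem_smul_set, inner_smul_right, smul_eq_mul]
  constructor
  · rintro ⟨w, hw, w', hw', rfl⟩
    exact ⟨_, ⟨w, hw, w', hw', rfl⟩, rfl⟩
  · rintro ⟨_, ⟨w, hw, w', hw', rfl⟩, rfl⟩
    exact ⟨w, hw, w', hw', rfl⟩

/-- The combined width of nonempty parameter sets is nonnegative. -/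
theorem multiWidth_nonneg {d m : ℕ} {W : Fin m → Set (EuclideanSpace ℝ (Fin d))}
    (hW : ∀ i, (W i).Nonempty) (a : EuclideanSpace ℝ (Fin d)) : 0 ≤ multiWidth W a :=
  Real.iSup_nonneg fun i => linWidth_nonneg (hW i) a

/-- The combined width is positively homogeneous in the action. -/
theorem multiWidth_smul {d m : ℕ} (W : Fin m → Set (EuclideanSpace ℝ (Fin d))) {c : ℝ}
    (hc : 0 ≤ c) (a : EuclideanSpace ℝ (Fin d)) :
    multiWidth W (c • a) = c * multiWidth W a := by
  simp only [multiWidth, linWidth_smul _ hc, Real.mul_iSup_of_nonneg hc]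

/-- polytopic constraints. If each `W_i` is nonempty with vectors of norm at
most `1`, `b > 0`, `‖ã‖ ≤ D_a`, `ã` is optimistically feasible for each constraint,
`γ ∈ [0,1]` with `γ ≥ b/(b + Δ(ã))` where `Δ(a) = max_i Δ_{W_i}(a)`, and `ℓ` is
`D_ℓ`-Lipschitz, then `ℓ(γ ã) − ℓ(ã) ≤ (D_ℓ D_a / b) · Δ(γ ã)`. -/
theorem poly_scaling_loss_increase_bound
    {d m : ℕ} (hm : 0 < m) (W : Fin m → Set (EuclideanSpace ℝ (Fin d)))
    (hne : ∀ i, (W i).Nonempty)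
    (hW : ∀ i, ∀ w ∈ W i, ‖w‖ ≤ 1) (b Da Dl : ℝ) (hb : 0 < b) (hDa : 0 < Da) (hDl : 0 ≤ Dl)
    (atil : EuclideanSpace ℝ (Fin d)) (hnorm : ‖atil‖ ≤ Da)
    (hopt : ∀ i, sInf {y : ℝ | ∃ w ∈ W i, y = ⟪w, atil⟫} ≤ b)
    (γ : ℝ) (hγ : γ ∈ Set.Icc (0 : ℝ) 1) (hγlb : b / (b + multiWidth W atil) ≤ γ)
    (ℓ : EuclideanSpace ℝ (Fin d) → ℝ)
    (hLip : ∀ x y, dist (ℓ x) (ℓ y) ≤ Dl * dist x y) :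
    ℓ (γ • atil) - ℓ atil ≤ (Dl * Da / b) * multiWidth W (γ • atil) := by
  have hΔ : 0 ≤ multiWidth W atil := multiWidth_nonneg hne atil
  have hscale : (1 - γ) * b ≤ γ * multiWidth W atil := by
    rw [div_le_iff₀ (by linarith)] at hγlb
    linarith
  have hdist : dist (γ • atil) atil ≤ (1 - γ) * Da := by
    have hsub : γ • atil - atil = (γ - 1) • atil := by rw [sub_smul, one_smul]
    rw [dist_eq_norm, hsub, norm_smul, Real.norm_eq_abs, abs_sub_comm,
      abs_of_nonneg (sub_nonneg.2 hγ.2)]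
    exact mul_le_mul_of_nonneg_left hnorm (sub_nonneg.2 hγ.2)
  rw [multiWidth_smul W hγ.1]
  calc ℓ (γ • atil) - ℓ atil ≤ dist (ℓ (γ • atil)) (ℓ atil) := le_abs_self _
    _ ≤ Dl * dist (γ • atil) atil := hLip _ _
    _ ≤ Dl * ((1 - γ) * Da) := mul_le_mul_of_nonneg_left hdist hDl
    _ = (Dl * Da / b) * ((1 - γ) * b) := by field_simp
    _ ≤ (Dl * Da / b) * (γ * multiWidth W atil) :=
      mul_le_mul_of_nonneg_left hscale (by positivity)
end
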